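/- arXiv:1611.02108 — 5 statements merged into one kernel-verified Lean document; each statement's English description precedes it below -/
import Mathlib

section
/- Let z, z' ∈ [0,1] and u, u' : Fin n → ℝ satisfy (2 − z')·(2·(u i) − 1) = (2 − z)·(2·(u' i) − 1) for every i. Then for every strict de Morgan term function g on n variables, (2 − z')·(2·g(u) − 1) = (2 − z)·(2·g(u') − 1). -/
/-- The strict de Morgan term functions on `n` variables: the smallest set of functions
`(Fin n → ℝ) → ℝ` containing the coordinate projections and closed under pointwise
binary `min`, pointwise binary `max`, and the involution `g ↦ (u ↦ 1 - g u)`. -/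
inductive StrictDeMorganTerm (n : ℕ) : ((Fin n → ℝ) → ℝ) → Prop
  | proj (i : Fin n) : StrictDeMorganTerm n (fun u => u i)
  | min {g h : (Fin n → ℝ) → ℝ} : StrictDeMorganTerm n g → StrictDeMorganTerm n h →
      StrictDeMorganTerm n (fun u => min (g u) (h u))
  | max {g h : (Fin n → ℝ) → ℝ} : StrictDeMorganTerm n g → StrictDeMorganTerm n h →
      StrictDeMorganTerm n (fun u => max (g u) (h u))
  | inv {g : (Fin n → ℝ) → ℝ} : StrictDeMorganTerm n g →
      StrictDeMorganTerm n (fun u => 1 - g u)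

/-- Scaling a displacement from the center `1/2` by a nonnegative factor is monotone. -/
theorem monotone_mul_two_mul_sub_one {c : ℝ} (hc : 0 ≤ c) :
    Monotone fun x : ℝ => c * (2 * x - 1) := by
  intro x y hxy
  dsimp only
  gcongr

/-- Collinearity with the center `(1/2, …, 1/2, 2)` is preserved by every strict
de Morgan term function. -/
theorem collinear_center_strict_term (n : ℕ) (z z' : ℝ)
    (hz : z ∈ Set.Icc (0:ℝ) 1) (hz' : z' ∈ Set.Icc (0:ℝ) 1)
    (u u' : Fin n → ℝ)
    (h : ∀ i, (2 - z') * (2 * u i - 1) = (2 - z) * (2 * u' i - 1))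
    (g : (Fin n → ℝ) → ℝ) (hg : StrictDeMorganTerm n g) :
    (2 - z') * (2 * g u - 1) = (2 - z) * (2 * g u' - 1) := by
  have hm := monotone_mul_two_mul_sub_one (sub_nonneg.2 (hz.2.trans one_le_two))
  have hm' := monotone_mul_two_mul_sub_one (sub_nonneg.2 (hz'.2.trans one_le_two))
  induction hg with
  | proj i => exact h i
  | min _ _ ihg ihh => exact hm'.map_min.trans ((congrArg₂ min ihg ihh).trans hm.map_min.symm)
  | max _ _ ihg ihh => exact hm'.map_max.trans ((congrArg₂ max ihg ihh).trans hm.map_max.symm)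
  | inv _ ih => linarith
end

section
/- Suppose that for each natural number n we are given a function r_n from (Fin n → [0,1]) × [0,1] to itself such that r_n ∘ r_n = r_n and such that r_n(u, z) = r_n(u', z') holds if and only if (2 − z')·(2·(u i) − 1) = (2 − z)·(2·(u' i) − 1) for all i. Then for all n, m and every strict de Morgan term map f : (Fin n → [0,1]) → (Fin m → [0,1]), one has r_m ∘ (f × id) ∘ r_n = r_m ∘ (f × id), where (f × id)(u, z) = (f u, z). -/
/-- A strict de Morgan term map `[0,1]^n → [0,1]^m`: each coordinate function is the
restriction of a strict de Morgan term function. -/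
def IsStrictDeMorganMap (n m : ℕ)
    (f : (Fin n → Set.Icc (0:ℝ) 1) → (Fin m → Set.Icc (0:ℝ) 1)) : Prop :=
  ∀ j : Fin m, ∃ g : (Fin n → ℝ) → ℝ, StrictDeMorganTerm n g ∧
    ∀ u, (f u j : ℝ) = g (fun i => (u i : ℝ))

/-- Affine maps `x ↦ c * (2 * x - 1)` with `0 ≤ c` commute with `min`. -/
theorem mul_two_mul_min_sub_one {c : ℝ} (hc : 0 ≤ c) (x y : ℝ) :
    c * (2 * min x y - 1) = min (c * (2 * x - 1)) (c * (2 * y - 1)) :=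
  Monotone.map_min (f := fun x => c * (2 * x - 1)) fun _ _ h => by dsimp only; gcongr

/-- Affine maps `x ↦ c * (2 * x - 1)` with `0 ≤ c` commute with `max`. -/
theorem mul_two_mul_max_sub_one {c : ℝ} (hc : 0 ≤ c) (x y : ℝ) :
    c * (2 * max x y - 1) = max (c * (2 * x - 1)) (c * (2 * y - 1)) :=
  Monotone.map_max (f := fun x => c * (2 * x - 1)) fun _ _ h => by dsimp only; gcongr

/-- Strict de Morgan terms preserve collinearity with the center. -/
theorem StrictDeMorganTerm.mul_two_mul_sub_one_eq {n : ℕ} {g : (Fin n → ℝ) → ℝ}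
    (hg : StrictDeMorganTerm n g) {a b : ℝ} (ha : 0 ≤ a) (hb : 0 ≤ b) {u v : Fin n → ℝ}
    (huv : ∀ i, a * (2 * u i - 1) = b * (2 * v i - 1)) :
    a * (2 * g u - 1) = b * (2 * g v - 1) := by
  induction hg with
  | proj i => exact huv i
  | min _ _ ihg ihh => simp only [mul_two_mul_min_sub_one ha, mul_two_mul_min_sub_one hb, ihg, ihh]
  | max _ _ ihg ihh => simp only [mul_two_mul_max_sub_one ha, mul_two_mul_max_sub_one hb, ihg, ihh]
  | inv _ ih => linear_combination -ih

/-- Uniformity of a family of central retractions with respect to strict de Morgan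
term maps: `r_m ∘ (f × id) ∘ r_n = r_m ∘ (f × id)`. -/
theorem central_retraction_uniform
    (r : ∀ n : ℕ, (Fin n → Set.Icc (0:ℝ) 1) × Set.Icc (0:ℝ) 1 →
                  (Fin n → Set.Icc (0:ℝ) 1) × Set.Icc (0:ℝ) 1)
    (hidem : ∀ n, r n ∘ r n = r n)
    (hcol : ∀ n p q, r n p = r n q ↔
      ∀ i, (2 - (q.2 : ℝ)) * (2 * (p.1 i : ℝ) - 1) =
           (2 - (p.2 : ℝ)) * (2 * (q.1 i : ℝ) - 1))
    (n m : ℕ) (f : (Fin n → Set.Icc (0:ℝ) 1) → (Fin m → Set.Icc (0:ℝ) 1))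
    (hf : IsStrictDeMorganMap n m f) :
    r m ∘ (fun p => (f p.1, p.2)) ∘ r n = r m ∘ (fun p => (f p.1, p.2)) := by
  funext p
  refine (hcol m _ _).2 fun j => ?_
  obtain ⟨g, hg, hfg⟩ := hf j
  simp only [Function.comp_apply, hfg]
  have hp := p.2.2.2
  have hq := (r n p).2.2.2
  exact hg.mul_two_mul_sub_one_eq (by linarith) (by linarith)
    ((hcol n _ _).1 (congrFun (hidem n) p))
end

section
/- There exists a family of functions r_n from (Fin n → [0,1]) × [0,1] to itself, one for each natural number n, such that each r_n is idempotent (r_n ∘ r_n = r_n), such that (1) r_n(u, z) = (u, z) if and only if z = 0 or there exists i with u i = 0 or u i = 1, and such that (2) for all n, m and every strict de Morgan term map f : (Fin n → [0,1]) → (Fin m → [0,1]), r_m ∘ (f × id) ∘ r_n = r_m ∘ (f × id), where (f × id)(u, z) = (f u, z). -/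
/-- The homothety of ratio `t` centred at `c`. -/
def homothetyReal (c t x : ℝ) : ℝ := c + t * (x - c)

/-- Strict de Morgan terms commute with homotheties of nonnegative ratio about the centre of
the cube. -/
theorem StrictDeMorganTerm.map_homothety {n : ℕ} {g : (Fin n → ℝ) → ℝ}
    (hg : StrictDeMorganTerm n g) {t : ℝ} (ht : 0 ≤ t) (u : Fin n → ℝ) :
    g (fun i => homothetyReal (1 / 2) t (u i)) = homothetyReal (1 / 2) t (g u) := by
  have hmono : Monotone (homothetyReal (1 / 2) t) := fun x y hxy => by
    unfold homothetyReal
    gcongr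
  induction hg with
  | proj i => rfl
  | min _ _ ihg ihh => simp only [ihg, ihh, hmono.map_min]
  | max _ _ ihg ihh => simp only [ihg, ihh, hmono.map_max]
  | inv _ ih =>
    simp only [ih]
    unfold homothetyReal
    ring

/-- The gauge of the cylinder over the cube as seen from the point at height `2` above the
centre of its base: it is `1` exactly on the bottom and the side faces. -/
noncomputable def cylinderGauge {n : ℕ} (u : Fin n → ℝ) (z : ℝ) : ℝ :=
  max ‖fun i => 2 * u i - 1‖ (1 - z / 2)

theorem cylinderGauge_homothety {n : ℕ} (u : Fin n → ℝ) (z : ℝ) {t : ℝ} (ht : 0 ≤ t) :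
    cylinderGauge (fun i => homothetyReal (1 / 2) t (u i)) (homothetyReal 2 t z) =
      t * cylinderGauge u z := by
  have hu : (fun i => 2 * homothetyReal (1 / 2) t (u i) - 1) = t • fun i => 2 * u i - 1 := by
    funext i
    simp only [homothetyReal, Pi.smul_apply, smul_eq_mul]
    ring
  have hz : 1 - homothetyReal 2 t z / 2 = t * (1 - z / 2) := by
    unfold homothetyReal
    ring
  rw [cylinderGauge, cylinderGauge, hu, hz, norm_smul, Real.norm_of_nonneg ht,
    mul_max_of_nonneg _ _ ht]

theorem abs_le_cylinderGauge {n : ℕ} (u : Fin n → ℝ) (z : ℝ) (i : Fin n) :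
    |2 * u i - 1| ≤ cylinderGauge u z :=
  (norm_le_pi_norm (fun i => 2 * u i - 1) i).trans (le_max_left _ _)

theorem cylinderGauge_pos {n : ℕ} (u : Fin n → ℝ) {z : ℝ} (hz : z ≤ 1) :
    0 < cylinderGauge u z :=
  lt_max_of_lt_right (by linarith)

theorem cylinderGauge_le_one {n : ℕ} {u : Fin n → ℝ} {z : ℝ}
    (hu : ∀ i, u i ∈ Set.Icc (0 : ℝ) 1) (hz : 0 ≤ z) : cylinderGauge u z ≤ 1 := by
  refine max_le ((pi_norm_le_iff_of_nonneg zero_le_one).2 fun i => ?_) (by linarith)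
  rw [Real.norm_eq_abs, abs_le]
  constructor <;> linarith [(hu i).1, (hu i).2]

theorem cylinderGauge_eq_one_iff {n : ℕ} {u : Fin n → ℝ} {z : ℝ}
    (hu : ∀ i, u i ∈ Set.Icc (0 : ℝ) 1) (hz : 0 ≤ z) :
    cylinderGauge u z = 1 ↔ z = 0 ∨ ∃ i, u i = 0 ∨ u i = 1 := by
  constructor
  · intro h
    by_contra! hne
    obtain ⟨hz0, hi⟩ := hne
    refine h.not_lt (max_lt ((pi_norm_lt_iff zero_lt_one).2 fun i => ?_) ?_)
    · have h0 := (hu i).1.lt_of_ne' (hi i).1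
      have h1 := (hu i).2.lt_of_ne (hi i).2
      rw [Real.norm_eq_abs, abs_lt]
      constructor <;> linarith
    · linarith [hz.lt_of_ne' hz0]
  · intro h
    refine le_antisymm (cylinderGauge_le_one hu hz) ?_
    obtain rfl | ⟨i, hi⟩ := h
    · exact le_max_of_le_right (by norm_num)
    · refine le_trans ?_ (abs_le_cylinderGauge u z i)
      obtain hi | hi := hi <;> norm_num [hi]

theorem homothety_inv_cylinderGauge_mem_base {n : ℕ} (u : Fin n → ℝ) {z : ℝ} (hz : z ≤ 1)
    (i : Fin n) :
    homothetyReal (1 / 2) (cylinderGauge u z)⁻¹ (u i) ∈ Set.Icc (0 : ℝ) 1 := by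
  have hpos := cylinderGauge_pos u hz
  have h : |(cylinderGauge u z)⁻¹ * (2 * u i - 1)| ≤ 1 := by
    rw [abs_mul, abs_of_pos (inv_pos.2 hpos)]
    exact inv_mul_le_one_of_le₀ (abs_le_cylinderGauge u z i) hpos.le
  rw [abs_le] at h
  unfold homothetyReal
  constructor <;> linarith [h.1, h.2]

theorem homothety_inv_cylinderGauge_mem_height {n : ℕ} {u : Fin n → ℝ} {z : ℝ}
    (hu : ∀ i, u i ∈ Set.Icc (0 : ℝ) 1) (hz : z ∈ Set.Icc (0 : ℝ) 1) :
    homothetyReal 2 (cylinderGauge u z)⁻¹ z ∈ Set.Icc (0 : ℝ) 1 := by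
  have hpos := cylinderGauge_pos u hz.2
  have hlow : (cylinderGauge u z)⁻¹ * (1 - z / 2) ≤ 1 :=
    inv_mul_le_one_of_le₀ (le_max_right _ _) hpos.le
  have hinv : 1 ≤ (cylinderGauge u z)⁻¹ := (one_le_inv₀ hpos).2 (cylinderGauge_le_one hu hz.1)
  unfold homothetyReal
  constructor
  · linarith
  · nlinarith [hz.2]

/-- The radial projection of the cylinder onto its bottom and side faces, from the point at
height `2` above the centre of the base. -/
noncomputable def radialRetraction (n : ℕ)
    (p : (Fin n → Set.Icc (0 : ℝ) 1) × Set.Icc (0 : ℝ) 1) :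
    (Fin n → Set.Icc (0 : ℝ) 1) × Set.Icc (0 : ℝ) 1 :=
  (fun i => ⟨_, homothety_inv_cylinderGauge_mem_base (fun i => (p.1 i : ℝ)) p.2.2.2 i⟩,
    ⟨_, homothety_inv_cylinderGauge_mem_height (fun i => (p.1 i).2) p.2.2⟩)

/-- Points on a common ray from the centre of projection have the same image. -/
theorem radialRetraction_eq_of_homothety {n : ℕ}
    {p q : (Fin n → Set.Icc (0 : ℝ) 1) × Set.Icc (0 : ℝ) 1} {t : ℝ} (ht : 0 < t)
    (hbase : ∀ i, (q.1 i : ℝ) = homothetyReal (1 / 2) t (p.1 i))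
    (hheight : (q.2 : ℝ) = homothetyReal 2 t p.2) :
    radialRetraction n q = radialRetraction n p := by
  have hcomp (c s x : ℝ) :
      homothetyReal c (t * s)⁻¹ (homothetyReal c t x) = homothetyReal c s⁻¹ x := by
    simp only [homothetyReal, mul_inv, add_sub_cancel_left]
    field_simp
  have hgauge := cylinderGauge_homothety (fun i => (p.1 i : ℝ)) p.2 ht.le
  refine Prod.ext (funext fun i => Subtype.ext ?_) (Subtype.ext ?_) <;>
    simp only [radialRetraction, hbase, hheight, hgauge, hcomp]

theorem radialRetraction_eq_self_iff {n : ℕ}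
    (p : (Fin n → Set.Icc (0 : ℝ) 1) × Set.Icc (0 : ℝ) 1) :
    radialRetraction n p = p ↔ cylinderGauge (fun i => (p.1 i : ℝ)) p.2 = 1 := by
  constructor
  · intro h
    have hheight : homothetyReal 2 (cylinderGauge (fun i => (p.1 i : ℝ)) p.2)⁻¹ p.2 = p.2 :=
      congrArg (fun q => (q.2 : ℝ)) h
    have hne : (p.2 : ℝ) - 2 ≠ 0 := by linarith [p.2.2.2]
    have hmul : (cylinderGauge (fun i => (p.1 i : ℝ)) p.2)⁻¹ * ((p.2 : ℝ) - 2) =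
        1 * ((p.2 : ℝ) - 2) := by
      unfold homothetyReal at hheight
      linarith
    exact inv_eq_one.1 (mul_right_cancel₀ hne hmul)
  · intro h
    refine Prod.ext (funext fun i => Subtype.ext ?_) (Subtype.ext ?_) <;>
      simp [radialRetraction, h, homothetyReal]

/-- There exists a uniform family of idempotent retractions `r_n` of the cylinders
`[0,1]^n × [0,1]` whose fixed points are exactly the bottom and the side faces. -/
theorem exists_uniform_retraction_family :
    ∃ r : ∀ n : ℕ, (Fin n → Set.Icc (0:ℝ) 1) × Set.Icc (0:ℝ) 1 →
                   (Fin n → Set.Icc (0:ℝ) 1) × Set.Icc (0:ℝ) 1,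
      (∀ n, r n ∘ r n = r n) ∧
      (∀ n p, r n p = p ↔ ((p.2 : ℝ) = 0 ∨ ∃ i, (p.1 i : ℝ) = 0 ∨ (p.1 i : ℝ) = 1)) ∧
      (∀ n m (f : (Fin n → Set.Icc (0:ℝ) 1) → (Fin m → Set.Icc (0:ℝ) 1)),
        IsStrictDeMorganMap n m f →
        r m ∘ (fun p => (f p.1, p.2)) ∘ r n = r m ∘ (fun p => (f p.1, p.2))) := by
  refine ⟨radialRetraction, fun n => funext fun p => ?_, fun n p => ?_,
    fun n m f hf => funext fun p => ?_⟩
  · exact radialRetraction_eq_of_homothety (inv_pos.2 (cylinderGauge_pos _ p.2.2.2))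
      (fun _ => rfl) rfl
  · rw [radialRetraction_eq_self_iff,
      cylinderGauge_eq_one_iff (fun i => (p.1 i).2) p.2.2.1]
  · have ht := inv_pos.2 (cylinderGauge_pos (fun i => (p.1 i : ℝ)) p.2.2.2)
    refine radialRetraction_eq_of_homothety ht (fun j => ?_) rfl
    obtain ⟨g, hg, hfg⟩ := hf j
    rw [hfg, ← hg.map_homothety ht.le]
    exact hfg _
end

section
/- Let n be a natural number and let L ⊆ [0,1]^n be a finite union of faces of the cube. Then the subset K = ([0,1]^n × {0}) ∪ (L × [0,1]) of [0,1]^n × [0,1] is a retract of [0,1]^n × [0,1]: there exists a continuous map ρ : [0,1]^n × [0,1] → [0,1]^n × [0,1] whose image is contained in K and which satisfies ρ(p) = p for every p ∈ K. -/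
/-- The face of the cube `[0,1]^n` determined by a finite set `c` of pairs `(i, b)`:
the set of points `u` with `u i = 1` if `b = true` and `u i = 0` if `b = false`,
for every `(i, b) ∈ c`. -/
def Face (n : ℕ) (c : Finset (Fin n × Bool)) : Set (Fin n → Set.Icc (0:ℝ) 1) :=
  {u | ∀ p ∈ c, (u p.1 : ℝ) = if p.2 then 1 else 0}

/-- A face of the cube is closed. -/
lemma isClosed_face (n : ℕ) (c : Finset (Fin n × Bool)) : IsClosed (Face n c) := by
  have h : Face n c = ⋂ p ∈ c, {u | (u p.1 : ℝ) = if p.2 then 1 else 0} := by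
    ext u
    simp [Face]
  rw [h]
  exact isClosed_biInter fun p _ => isClosed_eq (by fun_prop) continuous_const

/-- Expand the interval about its midpoint, by an amount governed by `a`, and clamp the result
to the interval. For `0 ≤ a ≤ 1/3` this sends `[0,a]` to `0` and `[1-a,1]` to `1`. -/
noncomputable def snap (a : ℝ) (x : Set.Icc (0:ℝ) 1) : Set.Icc (0:ℝ) 1 :=
  Set.projIcc 0 1 zero_le_one ((x : ℝ) + 3 * a * (2 * x - 1))

lemma snap_zero (x : Set.Icc (0:ℝ) 1) : snap 0 x = x := by
  simp [snap]

lemma snap_eq_zero {a : ℝ} {x : Set.Icc (0:ℝ) 1} (ha : 0 ≤ a) (ha' : a ≤ 1 / 3)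
    (hx : (x : ℝ) ≤ a) : (snap a x : ℝ) = 0 := by
  rw [snap, Set.projIcc_of_le_left]
  nlinarith

lemma snap_eq_one {a : ℝ} {x : Set.Icc (0:ℝ) 1} (ha : 0 ≤ a) (ha' : a ≤ 1 / 3)
    (hx : 1 - a ≤ x) : (snap a x : ℝ) = 1 := by
  rw [snap, Set.projIcc_of_right_le]
  nlinarith

/-- Snapping a point by its distance to a point of a face lands in that face. -/
lemma snap_mem_face {n : ℕ} {c : Finset (Fin n × Bool)} {x y : Fin n → Set.Icc (0:ℝ) 1}
    (hy : y ∈ Face n c) (hxy : dist x y ≤ 1 / 3) :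
    (fun i => snap (dist x y) (x i)) ∈ Face n c := by
  rintro ⟨i, b⟩ hp
  have hi : |(x i : ℝ) - y i| ≤ dist x y := dist_le_pi_dist x y i
  have hb : (y i : ℝ) = if b then 1 else 0 := hy _ hp
  obtain ⟨h₁, h₂⟩ := abs_le.1 hi
  cases b
  · simp only [Bool.false_eq_true, if_false] at hb ⊢
    exact snap_eq_zero dist_nonneg hxy (by linarith)
  · simp only [if_true] at hb ⊢
    exact snap_eq_one dist_nonneg hxy (by linarith)

/-- If `L ⊆ [0,1]^n` is a finite union of faces, then
`K = ([0,1]^n × {0}) ∪ (L × [0,1])` is a retract of the cylinder `[0,1]^n × [0,1]`. -/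
theorem retract_onto_open_box (n : ℕ) (L : Set (Fin n → Set.Icc (0:ℝ) 1))
    (hL : ∃ S : Finset (Finset (Fin n × Bool)), L = ⋃ c ∈ S, Face n c) :
    ∃ ρ : (Fin n → Set.Icc (0:ℝ) 1) × Set.Icc (0:ℝ) 1 →
          (Fin n → Set.Icc (0:ℝ) 1) × Set.Icc (0:ℝ) 1,
      Continuous ρ ∧
      (∀ p, ρ p ∈ {q : (Fin n → Set.Icc (0:ℝ) 1) × Set.Icc (0:ℝ) 1 |
        (q.2 : ℝ) = 0 ∨ q.1 ∈ L}) ∧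
      (∀ p ∈ {q : (Fin n → Set.Icc (0:ℝ) 1) × Set.Icc (0:ℝ) 1 |
        (q.2 : ℝ) = 0 ∨ q.1 ∈ L}, ρ p = p) := by
  obtain ⟨S, hS⟩ := hL
  have hclosed : IsClosed L := by
    rw [hS]
    exact S.finite_toSet.isClosed_biUnion fun c _ => isClosed_face n c
  rcases L.eq_empty_or_nonempty with rfl | hne
  · refine ⟨fun p => (p.1, 0), by fun_prop, fun p => Or.inl rfl, ?_⟩
    rintro ⟨x, t⟩ (h | h)
    · exact Prod.ext rfl (Subtype.ext h.symm)
    · exact h.elim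
  have hd : Continuous fun x => Metric.infDist x L := Metric.continuous_infDist_pt L
  refine ⟨fun p => (fun i => snap (min (min (p.2 : ℝ) (Metric.infDist p.1 L)) (1 / 3)) (p.1 i),
    Set.projIcc 0 1 zero_le_one ((p.2 : ℝ) - 3 * Metric.infDist p.1 L)), ?_, ?_, ?_⟩
  · unfold snap
    have hproj : Continuous (Set.projIcc (0:ℝ) 1 zero_le_one) := continuous_projIcc
    fun_prop
  · rintro ⟨x, t⟩
    rcases le_or_gt (t : ℝ) (3 * Metric.infDist x L) with h | h
    · left
      simp only
      rw [Set.projIcc_of_le_left _ (by linarith)]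
    · right
      obtain ⟨y, hyL, hy⟩ := hclosed.isCompact.exists_infDist_eq_dist hne x
      have ht := t.2.2
      have h0 : 0 ≤ Metric.infDist x L := Metric.infDist_nonneg
      simp only
      rw [min_eq_right (by linarith : Metric.infDist x L ≤ t), min_eq_left (by linarith), hy]
      rw [hS] at hyL ⊢
      simp only [Set.mem_iUnion] at hyL ⊢
      obtain ⟨c, hc, hyc⟩ := hyL
      exact ⟨c, hc, snap_mem_face hyc (by linarith)⟩
  · rintro ⟨x, t⟩ h
    have h0 : 0 ≤ Metric.infDist x L := Metric.infDist_nonneg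
    have ht := t.2.1
    have hmin : min (min (t : ℝ) (Metric.infDist x L)) (1 / 3) = 0 := by
      rcases h with h | h
      · simp only at h
        rw [h, min_eq_left h0, min_eq_left (by norm_num)]
      · rw [Metric.infDist_zero_of_mem h, min_eq_right ht, min_eq_left (by norm_num)]
    refine Prod.ext (funext fun i => ?_) ?_
    · simp only [hmin, snap_zero]
    · rcases h with h | h
      · simp only at h ⊢
        rw [Set.projIcc_of_le_left _ (by linarith)]
        exact Subtype.ext h.symm
      · simp only at h ⊢
        rw [Metric.infDist_zero_of_mem h, mul_zero, sub_zero, Set.projIcc_val]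
end

section
/- Let N be a type of names. For i ∈ N and b ∈ Bool set B(i,b) = {g : N → Option Bool | g i = some b}, and let 𝔽 be the smallest collection of subsets of (N → Option Bool) containing the empty set, the full set, and every B(i,b), and closed under binary union and binary intersection. For φ ∈ 𝔽 and i ∈ N define ∀i.φ = {g | Function.update g i none ∈ φ}, φ(i0) = {g | Function.update g i (some false) ∈ φ}, and φ(i1) = {g | Function.update g i (some true) ∈ φ}. Then for every φ ∈ 𝔽 and every i ∈ N: φ = (∀i.φ) ∪ (φ ∩ B(i,false)) ∪ (φ ∩ B(i,true)); moreover φ ∩ B(i,false) ⊆ φ(i0) and φ ∩ B(i,true) ⊆ φ(i1). -/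
/-- The face lattice over a type `N` of names, realized concretely: the smallest
collection of subsets of `N → Option Bool` containing the empty set, the full set,
and each generator `{g | g i = some b}`, and closed under binary union and binary
intersection. -/
inductive FaceLat (N : Type*) : Set (N → Option Bool) → Prop
  | empty : FaceLat N ∅
  | full : FaceLat N Set.univ
  | gen (i : N) (b : Bool) : FaceLat N {g | g i = some b}
  | union {φ ψ : Set (N → Option Bool)} :
      FaceLat N φ → FaceLat N ψ → FaceLat N (φ ∪ ψ)
  | inter {φ ψ : Set (N → Option Bool)} :
      FaceLat N φ → FaceLat N ψ → FaceLat N (φ ∩ ψ)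

/-- Members of the face lattice are stable under defining a valuation at one more name. -/
theorem FaceLat.mem_of_update_none_mem {N : Type*} [DecidableEq N]
    {φ : Set (N → Option Bool)} (hφ : FaceLat N φ) {g : N → Option Bool} {i : N}
    (hg : Function.update g i none ∈ φ) : g ∈ φ := by
  induction hφ with
  | empty => exact hg
  | full => trivial
  | gen j b =>
    rcases eq_or_ne j i with rfl | hji
    · simp at hg
    · simpa [Function.update_of_ne hji] using hg
  | union _ _ ihφ ihψ => exact hg.imp ihφ ihψ
  | inter _ _ ihφ ihψ => exact hg.imp ihφ ihψ

/-- The decomposition lemma for the face lattice: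
`φ = (∀i.φ) ∨ (φ ∧ (i=0)) ∨ (φ ∧ (i=1))`, together with
`φ ∧ (i=0) ≤ φ(i0)` and `φ ∧ (i=1) ≤ φ(i1)`. -/
theorem faceLat_decomposition (N : Type*) [DecidableEq N]
    (φ : Set (N → Option Bool)) (hφ : FaceLat N φ) (i : N) :
    φ = ({g | Function.update g i none ∈ φ} ∪
          (φ ∩ {g | g i = some false}) ∪ (φ ∩ {g | g i = some true})) ∧
    φ ∩ {g | g i = some false} ⊆ {g | Function.update g i (some false) ∈ φ} ∧
    φ ∩ {g | g i = some true} ⊆ {g | Function.update g i (some true) ∈ φ} := by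
  have update_mem (b : Bool) :
      φ ∩ {g | g i = some b} ⊆ {g | Function.update g i (some b) ∈ φ} := by
    rintro g ⟨hg, hgi⟩
    rwa [Set.mem_ofPred_eq, Function.update_eq_self_iff.mpr (Eq.symm hgi)]
  refine ⟨Set.Subset.antisymm (fun g hg => ?_) ?_, update_mem false, update_mem true⟩
  · rcases hgi : g i with _ | _ | _
    · refine Or.inl (Or.inl ?_)
      rwa [Set.mem_ofPred_eq, Function.update_eq_self_iff.mpr hgi.symm]
    · exact Or.inl (Or.inr ⟨hg, hgi⟩)
    · exact Or.inr ⟨hg, hgi⟩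
  · rintro g ((hg | hg) | hg)
    · exact hφ.mem_of_update_none_mem hg
    · exact hg.1
    · exact hg.1
end
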